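/- Let m and λ be natural numbers. Let K be a random variable uniformly distributed on the set of binary strings of length m (functions Fin m → Bool), and let sk be a random variable uniformly distributed on Fin (2^λ), with K and sk independent. Let (C_j), for j ranging over Fin (2^λ), be a family of pairwise disjoint subsets of the binary strings of length m (the decoding regions of an (m, λ) error-correcting code). Then the probability that K lands in the decoding region indexed by sk satisfies P(K ∈ C_{sk}) = 2^{-(m+λ)} · Σ_j |C_j| ≤ 2^{-λ}. -/

import Mathlib

open MeasureTheory ProbabilityTheory
open scoped ENNReal

/-- The probability that one of two independent, uniformly distributed variables lands in a finite
set selected by the other one. -/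
theorem measure_mem_of_indepFun_uniform {Ω α ι : Type*} [MeasurableSpace Ω] {P : Measure Ω}
    [Fintype α] [Nonempty α] [MeasurableSpace α] [MeasurableSingletonClass α]
    [Fintype ι] [Nonempty ι] [MeasurableSpace ι] [MeasurableSingletonClass ι]
    {X : Ω → α} {Y : Ω → ι} (hX : Measurable X) (hY : Measurable Y)
    (hXunif : Measure.map X P = (PMF.uniformOfFintype α).toMeasure)
    (hYunif : Measure.map Y P = (PMF.uniformOfFintype ι).toMeasure)
    (hindep : IndepFun X Y P) (C : ι → Finset α) :
    P {ω | X ω ∈ C (Y ω)} =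
      ∑ j, (C j).card / (Fintype.card α : ℝ≥0∞) * (Fintype.card ι : ℝ≥0∞)⁻¹ := by
  have hunion : {ω | X ω ∈ C (Y ω)} = ⋃ j, X ⁻¹' (C j : Set α) ∩ Y ⁻¹' {j} := by
    ext ω
    simp
  rw [hunion, measure_iUnion, tsum_fintype]
  · refine Finset.sum_congr rfl fun j _ => ?_
    rw [hindep.measure_inter_preimage_eq_mul _ _ (C j).measurableSet (measurableSet_singleton j),
      ← Measure.map_apply hX (C j).measurableSet,
      ← Measure.map_apply hY (measurableSet_singleton j), hXunif, hYunif,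
      PMF.toMeasure_uniformOfFintype_apply _ (C j).measurableSet,
      PMF.toMeasure_apply_singleton _ _ (measurableSet_singleton j),
      PMF.uniformOfFintype_apply]
    simp
  · intro i j hij
    refine Set.disjoint_left.2 ?_
    rintro ω ⟨-, rfl⟩ ⟨-, h⟩
    exact hij h
  · exact fun j => (hX (C j).measurableSet).inter (hY (measurableSet_singleton j))

/-- Pairwise disjoint finite subsets of a finite type have total size at most that of the type. -/
theorem sum_card_le_card_of_pairwise_disjoint {α ι : Type*} [Fintype α] [Fintype ι]
    {C : ι → Finset α} (hC : Pairwise (Function.onFun Disjoint C)) :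
    ∑ j, (C j).card ≤ Fintype.card α := by
  classical
  rw [← Finset.card_biUnion fun i _ j _ hij => hC hij]
  exact Finset.card_le_univ _

/-- Core probabilistic bound in Theorem 1 of the paper: if `K` is a uniformly random
`m`-bit fingerprint, `sk` a uniformly random key index independent of `K`, and the
decoding regions `C j` are pairwise disjoint, then
`P(K ∈ C sk) = 2^{-(m+λ)} ∑_j |C j| ≤ 2^{-λ}`. -/
theorem fuzzy_extractor_guessing_bound
    (m lam : ℕ) {Ω : Type*} [MeasurableSpace Ω] (P : Measure Ω) [IsProbabilityMeasure P]
    (K : Ω → (Fin m → Bool)) (sk : Ω → Fin (2 ^ lam))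
    (hKmeas : Measurable K) (hskmeas : Measurable sk)
    (hKunif : Measure.map K P = (PMF.uniformOfFintype (Fin m → Bool)).toMeasure)
    (hskunif : Measure.map sk P = (PMF.uniformOfFintype (Fin (2 ^ lam))).toMeasure)
    (hindep : IndepFun K sk P)
    (C : Fin (2 ^ lam) → Finset (Fin m → Bool))
    (hdisj : Pairwise (Function.onFun Disjoint C)) :
    P {ω | K ω ∈ C (sk ω)} =
        (2 ^ (m + lam) : ℝ≥0∞)⁻¹ * ∑ j : Fin (2 ^ lam), ((C j).card : ℝ≥0∞) ∧
      P {ω | K ω ∈ C (sk ω)} ≤ (2 ^ lam : ℝ≥0∞)⁻¹ := by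
  have heq : P {ω | K ω ∈ C (sk ω)} =
      (2 ^ (m + lam) : ℝ≥0∞)⁻¹ * ∑ j : Fin (2 ^ lam), ((C j).card : ℝ≥0∞) := by
    rw [measure_mem_of_indepFun_uniform hKmeas hskmeas hKunif hskunif hindep, Finset.mul_sum]
    refine Finset.sum_congr rfl fun j _ => ?_
    rw [pow_add, ENNReal.mul_inv (by simp) (by simp)]
    simp only [Fintype.card_pi, Fintype.card_bool, Finset.prod_const, Finset.card_univ,
      Fintype.card_fin, Nat.cast_pow, Nat.cast_ofNat, div_eq_mul_inv]
    ring
  refine ⟨heq, ?_⟩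
  have hle : ∑ j : Fin (2 ^ lam), ((C j).card : ℝ≥0∞) ≤ 2 ^ m := by
    have h := sum_card_le_card_of_pairwise_disjoint hdisj
    simp only [Fintype.card_pi, Fintype.card_bool, Finset.prod_const, Finset.card_univ,
      Fintype.card_fin] at h
    exact_mod_cast h
  calc P {ω | K ω ∈ C (sk ω)}
      ≤ (2 ^ (m + lam) : ℝ≥0∞)⁻¹ * 2 ^ m := by
        rw [heq]
        gcongr
    _ = (2 ^ lam : ℝ≥0∞)⁻¹ := by
        rw [pow_add, ENNReal.mul_inv (by simp) (by simp), mul_right_comm,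
          ENNReal.inv_mul_cancel (by simp) (by simp), one_mul]
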